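/- Let E be a real inner product space, let x₁, …, xₙ ∈ E, and let σ > 0. Then the Gaussian-kernel Gram matrix K with entries K_{ij} = exp(−‖xᵢ − xⱼ‖² / (2σ²)) is symmetric positive semidefinite: for every c ∈ ℝⁿ, ∑_{i,j} cᵢ cⱼ exp(−‖xᵢ − xⱼ‖² / (2σ²)) ≥ 0. -/

import Mathlib

open Matrix

theorem quad_of_psd_aux {n : ℕ} {f : Fin n → Fin n → ℝ} (h : (Matrix.of f).PosSemidef)
    (c : Fin n → ℝ) : 0 ≤ ∑ i, ∑ j, c i * c j * f i j := by
  have := h.dotProduct_mulVec_nonneg c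
  simp only [dotProduct, mulVec, Matrix.of_apply, star_trivial, Finset.mul_sum] at this
  refine this.trans_eq (Finset.sum_congr rfl fun i _ => Finset.sum_congr rfl fun j _ => ?_)
  ring

theorem psd_of_quad_aux {n : ℕ} {f : Fin n → Fin n → ℝ} (hs : ∀ i j, f i j = f j i)
    (h : ∀ c : Fin n → ℝ, 0 ≤ ∑ i, ∑ j, c i * c j * f i j) : (Matrix.of f).PosSemidef := by
  rw [posSemidef_iff_dotProduct_mulVec]
  refine ⟨?_, fun c => ?_⟩
  · ext i j
    simpa using hs j i
  · simp only [dotProduct, mulVec, Matrix.of_apply, star_trivial, Finset.mul_sum]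
    refine (h c).trans_eq (Finset.sum_congr rfl fun i _ => Finset.sum_congr rfl fun j _ => ?_)
    ring

theorem psd_pow_aux {E : Type*} [NormedAddCommGroup E] [InnerProductSpace ℝ E]
    {n : ℕ} (x : Fin n → E) (k : ℕ) :
    (Matrix.of fun i j => (inner ℝ (x i) (x j)) ^ k).PosSemidef := by
  induction k with
  | zero =>
    refine psd_of_quad_aux (fun i j => by simp) fun c => ?_
    simp only [pow_zero, mul_one, ← Finset.sum_mul_sum]
    exact mul_self_nonneg _
  | succ k ih =>
    have := ih.hadamard (posSemidef_gram ℝ x)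
    have e : (Matrix.of fun i j => (inner ℝ (x i) (x j)) ^ (k + 1)) =
        (Matrix.of fun i j => (inner ℝ (x i) (x j)) ^ k) ⊙ gram ℝ x := by
      ext i j
      simp [pow_succ, gram_apply]
    rw [e]
    exact this

theorem quad_exp_aux {E : Type*} [NormedAddCommGroup E] [InnerProductSpace ℝ E]
    {n : ℕ} (x : Fin n → E) (s : ℝ) (hs : 0 ≤ s) (c : Fin n → ℝ) :
    0 ≤ ∑ i, ∑ j, c i * c j * Real.exp (s * inner ℝ (x i) (x j)) := by
  have H : HasSum (fun k : ℕ => ∑ i, ∑ j, c i * c j *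
      ((s * inner ℝ (x i) (x j)) ^ k / (k.factorial : ℝ)))
      (∑ i, ∑ j, c i * c j * Real.exp (s * inner ℝ (x i) (x j))) := by
    refine hasSum_sum fun i _ => hasSum_sum fun j _ => HasSum.mul_left _ ?_
    rw [Real.exp_eq_exp_ℝ]
    exact NormedSpace.expSeries_div_hasSum_exp _
  refine H.nonneg fun k => ?_
  have h := mul_nonneg (div_nonneg (pow_nonneg hs k) (Nat.cast_nonneg (α := ℝ) k.factorial))
    (quad_of_psd_aux (psd_pow_aux x k) c)
  simp only [Finset.mul_sum] at h
  refine h.trans_eq (Finset.sum_congr rfl fun i _ => Finset.sum_congr rfl fun j _ => ?_)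
  rw [mul_pow]
  ring

/-- The Gaussian-kernel Gram matrix over points `x₁, …, xₙ` in a real inner product
space is symmetric positive semidefinite: for every `c ∈ ℝⁿ`,
`∑ᵢⱼ cᵢ cⱼ exp(−‖xᵢ − xⱼ‖²/(2σ²)) ≥ 0`. -/
theorem gaussian_gram_posSemidef {E : Type*} [NormedAddCommGroup E] [InnerProductSpace ℝ E]
    (n : ℕ) (x : Fin n → E) (σ : ℝ) (hσ : 0 < σ) :
    (Matrix.of fun i j => Real.exp (-‖x i - x j‖ ^ 2 / (2 * σ ^ 2))).PosSemidef ∧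
    ∀ c : Fin n → ℝ,
      0 ≤ ∑ i, ∑ j, c i * c j * Real.exp (-‖x i - x j‖ ^ 2 / (2 * σ ^ 2)) := by
  have key : ∀ c : Fin n → ℝ,
      0 ≤ ∑ i, ∑ j, c i * c j * Real.exp (-‖x i - x j‖ ^ 2 / (2 * σ ^ 2)) := by
    intro c
    have h := quad_exp_aux x (1 / σ ^ 2) (by positivity)
      (fun i => c i * Real.exp (-‖x i‖ ^ 2 / (2 * σ ^ 2)))
    refine h.trans_eq (Finset.sum_congr rfl fun i _ => Finset.sum_congr rfl fun j _ => ?_)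
    have e : -‖x i - x j‖ ^ 2 / (2 * σ ^ 2) = -‖x i‖ ^ 2 / (2 * σ ^ 2) +
        -‖x j‖ ^ 2 / (2 * σ ^ 2) + 1 / σ ^ 2 * inner ℝ (x i) (x j) := by
      rw [norm_sub_sq_real]
      field_simp
      ring
    rw [e, Real.exp_add, Real.exp_add]
    ring
  exact ⟨psd_of_quad_aux (fun i j => by rw [norm_sub_rev]) key, key⟩
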